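/- For any set of 4 points in the unit square [0,1]^2, there exists an open axis-parallel rectangle contained in [0,1]^2 containing none of the 4 points and having area at least 1/4. -/

import Mathlib

def Esc (x y a b c d : ℝ) : Prop := x ≤ a ∨ b ≤ x ∨ y ≤ c ∨ d ≤ y

def Bad (x1 y1 x2 y2 x3 y3 x4 y4 : ℝ) : Prop :=
  ∀ a b c d : ℝ, 0 ≤ a → a < b → b ≤ 1 → 0 ≤ c → c < d → d ≤ 1 →
    Esc x1 y1 a b c d → Esc x2 y2 a b c d → Esc x3 y3 a b c d → Esc x4 y4 a b c d →
    (b - a) * (d - c) < 1 / 4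

lemma Bad.reflx {x1 y1 x2 y2 x3 y3 x4 y4 : ℝ} (h : Bad x1 y1 x2 y2 x3 y3 x4 y4) :
    Bad (1 - x1) y1 (1 - x2) y2 (1 - x3) y3 (1 - x4) y4 := by
  intro a b c d ha hab hb hc hcd hd e1 e2 e3 e4
  have := h (1 - b) (1 - a) c d (by linarith) (by linarith) (by linarith) hc hcd hd
    (by unfold Esc at *; grind) (by unfold Esc at *; grind)
    (by unfold Esc at *; grind) (by unfold Esc at *; grind)
  linarith

lemma Bad.swap {x1 y1 x2 y2 x3 y3 x4 y4 : ℝ} (h : Bad x1 y1 x2 y2 x3 y3 x4 y4) :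
    Bad y1 x1 y2 x2 y3 x3 y4 x4 := by
  intro a b c d ha hab hb hc hcd hd e1 e2 e3 e4
  have := h c d a b hc hcd hd ha hab hb
    (by unfold Esc at *; grind) (by unfold Esc at *; grind)
    (by unfold Esc at *; grind) (by unfold Esc at *; grind)
  linarith

lemma Bad.p12 {x1 y1 x2 y2 x3 y3 x4 y4 : ℝ} (h : Bad x1 y1 x2 y2 x3 y3 x4 y4) :
    Bad x2 y2 x1 y1 x3 y3 x4 y4 := by
  intro a b c d ha hab hb hc hcd hd e1 e2 e3 e4
  exact h a b c d ha hab hb hc hcd hd e2 e1 e3 e4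

lemma Bad.p23 {x1 y1 x2 y2 x3 y3 x4 y4 : ℝ} (h : Bad x1 y1 x2 y2 x3 y3 x4 y4) :
    Bad x1 y1 x3 y3 x2 y2 x4 y4 := by
  intro a b c d ha hab hb hc hcd hd e1 e2 e3 e4
  exact h a b c d ha hab hb hc hcd hd e1 e3 e2 e4

lemma Bad.p34 {x1 y1 x2 y2 x3 y3 x4 y4 : ℝ} (h : Bad x1 y1 x2 y2 x3 y3 x4 y4) :
    Bad x1 y1 x2 y2 x4 y4 x3 y3 := by
  intro a b c d ha hab hb hc hcd hd e1 e2 e3 e4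
  exact h a b c d ha hab hb hc hcd hd e1 e2 e4 e3

/-- Point 1 is LB, 2 is LT, 3 is RB, 4 is RT, and point 1 is leftmost and lowest. -/
lemma core {x1 y1 x2 y2 x3 y3 x4 y4 : ℝ} (h : Bad x1 y1 x2 y2 x3 y3 x4 y4)
    (p1 : 0 ≤ x1) (q1 : 0 ≤ y1) (hx : x1 ≤ x2) (hy : y1 ≤ y3)
    (a2 : x2 < 1/2) (a3 : 1/2 < x3) (a4 : 1/2 < x4)
    (b2 : 1/2 < y2) (b3 : y3 < 1/2) (b4 : 1/2 < y4)
    (c2 : y2 ≤ 1) (c3 : x3 ≤ 1) (c4 : x4 ≤ 1) (d4 : y4 ≤ 1) : False := by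
  have X1 : x1 < 1/4 := by
    by_contra! hh
    have := h 0 x1 0 1 (by linarith) (by linarith) (by linarith) (by linarith) (by linarith)
      (by linarith) (by unfold Esc; grind) (by unfold Esc; grind) (by unfold Esc; grind)
      (by unfold Esc; grind)
    linarith
  have Y1 : y1 < 1/4 := by
    by_contra! hh
    have := h 0 1 0 y1 (by linarith) (by linarith) (by linarith) (by linarith) (by linarith)
      (by linarith) (by unfold Esc; grind) (by unfold Esc; grind) (by unfold Esc; grind)
      (by unfold Esc; grind)
    linarith
  have X2 : x2 < 1/3 := by
    by_contra! hh
    have := h 0 x2 y1 1 (by linarith) (by linarith) (by linarith) (by linarith) (by linarith)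
      (by linarith) (by unfold Esc; grind) (by unfold Esc; grind) (by unfold Esc; grind)
      (by unfold Esc; grind)
    nlinarith
  have Y3 : y3 < 1/3 := by
    by_contra! hh
    have := h x1 1 0 y3 (by linarith) (by linarith) (by linarith) (by linarith) (by linarith)
      (by linarith) (by unfold Esc; grind) (by unfold Esc; grind) (by unfold Esc; grind)
      (by unfold Esc; grind)
    nlinarith
  have Y4 : y4 < 17/24 := by
    by_contra! hh
    have := h x2 1 y3 y4 (by linarith) (by linarith) (by linarith) (by linarith) (by linarith)
      (by linarith) (by unfold Esc; grind) (by unfold Esc; grind) (by unfold Esc; grind)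
      (by unfold Esc; grind)
    nlinarith
  have X4 : x4 < 17/24 := by
    by_contra! hh
    have := h x2 x4 y3 1 (by linarith) (by linarith) (by linarith) (by linarith) (by linarith)
      (by linarith) (by unfold Esc; grind) (by unfold Esc; grind) (by unfold Esc; grind)
      (by unfold Esc; grind)
    nlinarith
  have X3 : 3/4 < x3 := by
    by_contra! hh
    have := h (max x3 x4) 1 0 1 (by grind) (by grind) (by grind) (by linarith) (by linarith)
      (by linarith) (by unfold Esc; grind) (by unfold Esc; grind) (by unfold Esc; grind)
      (by unfold Esc; grind)
    grind
  have X4' : x4 < 7/12 := by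
    by_contra! hh
    have := h x2 x4 0 1 (by linarith) (by linarith) (by linarith) (by linarith) (by linarith)
      (by linarith) (by unfold Esc; grind) (by unfold Esc; grind) (by unfold Esc; grind)
      (by unfold Esc; grind)
    nlinarith
  have := h x4 1 y3 1 (by linarith) (by linarith) (by linarith) (by linarith) (by linarith)
      (by linarith) (by unfold Esc; grind) (by unfold Esc; grind) (by unfold Esc; grind)
      (by unfold Esc; grind)
  nlinarith

/-- Pinwheel: 1 leftmost, 2 top, 4 rightmost, 3 bottom. -/
lemma pin {x1 y1 x2 y2 x3 y3 x4 y4 : ℝ} (h : Bad x1 y1 x2 y2 x3 y3 x4 y4)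
    (p1 : 0 ≤ x1) (p3 : 0 ≤ y3) (p2 : y2 ≤ 1) (p4 : x4 ≤ 1)
    (h1 : x1 ≤ x2) (h2 : y4 ≤ y2) (h3 : y3 ≤ y1) (h4 : x3 ≤ x4)
    (a1 : x1 < 1/2) (a2 : x2 < 1/2) (a3 : 1/2 < x3) (a4 : 1/2 < x4)
    (b1 : y1 < 1/2) (b2 : 1/2 < y2) (b4 : 1/2 < y4) : False := by
  have X1 : x1 < 1/4 := by
    by_contra! hh
    have := h 0 x1 0 1 (by linarith) (by linarith) (by linarith) (by linarith) (by linarith)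
      (by linarith) (by unfold Esc; grind) (by unfold Esc; grind) (by unfold Esc; grind)
      (by unfold Esc; grind)
    linarith
  have X4 : 3/4 < x4 := by
    by_contra! hh
    have := h x4 1 0 1 (by linarith) (by linarith) (by linarith) (by linarith) (by linarith)
      (by linarith) (by unfold Esc; grind) (by unfold Esc; grind) (by unfold Esc; grind)
      (by unfold Esc; grind)
    linarith
  have Y3 : y3 < 1/4 := by
    by_contra! hh
    have := h 0 1 0 y3 (by linarith) (by linarith) (by linarith) (by linarith) (by linarith)
      (by linarith) (by unfold Esc; grind) (by unfold Esc; grind) (by unfold Esc; grind)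
      (by unfold Esc; grind)
    linarith
  have Y2 : 3/4 < y2 := by
    by_contra! hh
    have := h 0 1 y2 1 (by linarith) (by linarith) (by linarith) (by linarith) (by linarith)
      (by linarith) (by unfold Esc; grind) (by unfold Esc; grind) (by unfold Esc; grind)
      (by unfold Esc; grind)
    linarith
  have := h x1 x4 y3 y2 (by linarith) (by linarith) (by linarith) (by linarith) (by linarith)
      (by linarith) (by unfold Esc; grind) (by unfold Esc; grind) (by unfold Esc; grind)
      (by unfold Esc; grind)
  nlinarith

lemma Bad.refly {x1 y1 x2 y2 x3 y3 x4 y4 : ℝ} (h : Bad x1 y1 x2 y2 x3 y3 x4 y4) :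
    Bad x1 (1 - y1) x2 (1 - y2) x3 (1 - y3) x4 (1 - y4) := h.swap.reflx.swap

lemma quad {x1 y1 x2 y2 x3 y3 x4 y4 : ℝ} (h : Bad x1 y1 x2 y2 x3 y3 x4 y4)
    (p1 : 0 ≤ x1) (p2 : 0 ≤ x2) (p3 : x3 ≤ 1) (p4 : x4 ≤ 1)
    (q1 : 0 ≤ y1) (q2 : y2 ≤ 1) (q3 : 0 ≤ y3) (q4 : y4 ≤ 1)
    (a1 : x1 < 1/2) (a2 : x2 < 1/2) (a3 : 1/2 < x3) (a4 : 1/2 < x4)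
    (b1 : y1 < 1/2) (b2 : 1/2 < y2) (b3 : y3 < 1/2) (b4 : 1/2 < y4) : False := by
  have k1 : ¬ (x1 ≤ x2 ∧ y1 ≤ y3) := fun ⟨u, v⟩ => by
    apply core h <;> linarith
  have k2 : ¬ (x2 ≤ x1 ∧ y4 ≤ y2) := fun ⟨u, v⟩ => by
    apply core h.refly.p12.p34 <;> linarith
  have k3 : ¬ (x4 ≤ x3 ∧ y3 ≤ y1) := fun ⟨u, v⟩ => by
    apply core h.reflx.p23.p12.p34.p23 <;> linarith
  have k4 : ¬ (x3 ≤ x4 ∧ y2 ≤ y4) := fun ⟨u, v⟩ => by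
    apply core h.reflx.refly.p23.p12.p34.p23.p12.p34 <;> linarith
  rcases le_total x1 x2 with u | u
  · have v : y3 ≤ y1 := by grind
    have w : x3 ≤ x4 := by grind
    have z : y4 ≤ y2 := by grind
    apply pin h <;> linarith
  · have v : y2 ≤ y4 := by grind
    have w : x4 ≤ x3 := by grind
    have z : y1 ≤ y3 := by grind
    apply pin h.refly.p12.p34 <;> linarith

/-- Not three points in the left half. -/
lemma three {x1 y1 x2 y2 x3 y3 x4 y4 : ℝ} (h : Bad x1 y1 x2 y2 x3 y3 x4 y4)
    (p4 : 0 ≤ y4) (q4 : y4 ≤ 1)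
    (a1 : x1 ≤ 1/2) (a2 : x2 ≤ 1/2) (a3 : x3 ≤ 1/2) : False := by
  rcases le_total y4 (1/2) with u | u
  · have := h (1/2) 1 y4 1 (by linarith) (by linarith) (by linarith) (by linarith) (by linarith)
      (by linarith) (by unfold Esc; grind) (by unfold Esc; grind) (by unfold Esc; grind)
      (by unfold Esc; grind)
    linarith
  · have := h (1/2) 1 0 y4 (by linarith) (by linarith) (by linarith) (by linarith) (by linarith)
      (by linarith) (by unfold Esc; grind) (by unfold Esc; grind) (by unfold Esc; grind)
      (by unfold Esc; grind)
    linarith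

def Un (x y : ℝ) : Prop := (0 ≤ x ∧ x ≤ 1) ∧ 0 ≤ y ∧ y ≤ 1

/-- Among the four abscissae two are below and two above the midline. -/
lemma split {x1 y1 x2 y2 x3 y3 x4 y4 : ℝ} (h : Bad x1 y1 x2 y2 x3 y3 x4 y4)
    (u1 : Un x1 y1) (u2 : Un x2 y2) (u3 : Un x3 y3) (u4 : Un x4 y4) :
    (x1 < 1/2 ∧ x2 < 1/2 ∧ 1/2 < x3 ∧ 1/2 < x4) ∨ (x1 < 1/2 ∧ x3 < 1/2 ∧ 1/2 < x2 ∧ 1/2 < x4) ∨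
    (x1 < 1/2 ∧ x4 < 1/2 ∧ 1/2 < x2 ∧ 1/2 < x3) ∨ (x2 < 1/2 ∧ x3 < 1/2 ∧ 1/2 < x1 ∧ 1/2 < x4) ∨
    (x2 < 1/2 ∧ x4 < 1/2 ∧ 1/2 < x1 ∧ 1/2 < x3) ∨ (x3 < 1/2 ∧ x4 < 1/2 ∧ 1/2 < x1 ∧ 1/2 < x2) := by
  have t4 := three h u4.2.1 u4.2.2
  have t3 := three h.p34 u3.2.1 u3.2.2
  have t2 := three h.p23.p34 u2.2.1 u2.2.2
  have t1 := three h.p12.p23.p34 u1.2.1 u1.2.2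
  have s4 := three h.reflx u4.2.1 u4.2.2
  have s3 := three h.reflx.p34 u3.2.1 u3.2.2
  have s2 := three h.reflx.p23.p34 u2.2.1 u2.2.2
  have s1 := three h.reflx.p12.p23.p34 u1.2.1 u1.2.2
  clear h u1 u2 u3 u4
  have f : ∀ x : ℝ, x < 1/2 ∨ x = 1/2 ∨ 1/2 < x := fun x => lt_trichotomy _ _
  have e : ∀ x : ℝ, 1 - x ≤ 1/2 ↔ 1/2 ≤ x := fun x => by constructor <;> intro <;> linarith
  simp only [e] at *
  grind

lemma lr {x1 y1 x2 y2 x3 y3 x4 y4 : ℝ} (h : Bad x1 y1 x2 y2 x3 y3 x4 y4)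
    (u1 : Un x1 y1) (u2 : Un x2 y2) (u3 : Un x3 y3) (u4 : Un x4 y4)
    (a : x1 < 1/2 ∧ x2 < 1/2 ∧ 1/2 < x3 ∧ 1/2 < x4) : False := by
  obtain ⟨a1, a2, a3, a4⟩ := a
  have hs := split h.swap ⟨u1.2, u1.1⟩ ⟨u2.2, u2.1⟩ ⟨u3.2, u3.1⟩ ⟨u4.2, u4.1⟩
  unfold Un at *
  rcases hs with ⟨b1, b2, b3, b4⟩ | ⟨b1, b2, b3, b4⟩ | ⟨b1, b2, b3, b4⟩ | ⟨b1, b2, b3, b4⟩ |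
    ⟨b1, b2, b3, b4⟩ | ⟨b1, b2, b3, b4⟩
  · have := h 0 (1/2) (1/2) 1 (by linarith) (by linarith) (by linarith) (by linarith) (by linarith)
      (by linarith) (by unfold Esc; grind) (by unfold Esc; grind) (by unfold Esc; grind)
      (by unfold Esc; grind)
    linarith
  · apply quad h <;> linarith
  · apply quad h.p34 <;> linarith
  · apply quad h.p12 <;> linarith
  · apply quad h.p12.p34 <;> linarith
  · have := h 0 (1/2) 0 (1/2) (by linarith) (by linarith) (by linarith) (by linarith) (by linarith)
      (by linarith) (by unfold Esc; grind) (by unfold Esc; grind) (by unfold Esc; grind)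
      (by unfold Esc; grind)
    linarith

lemma all4 {x1 y1 x2 y2 x3 y3 x4 y4 : ℝ} (h : Bad x1 y1 x2 y2 x3 y3 x4 y4)
    (u1 : Un x1 y1) (u2 : Un x2 y2) (u3 : Un x3 y3) (u4 : Un x4 y4) : False := by
  rcases split h u1 u2 u3 u4 with b | b | b | b | b | b
  · exact lr h u1 u2 u3 u4 b
  · exact lr h.p23 u1 u3 u2 u4 b
  · exact lr h.p34.p23 u1 u4 u2 u3 b
  · exact lr h.p12.p23 u2 u3 u1 u4 b
  · exact lr h.p12.p34.p23 u2 u4 u1 u3 b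
  · exact lr h.p23.p12.p34.p23 u3 u4 u1 u2 b

/-- Any 4 points in the unit square admit an empty open axis-parallel
rectangle of area at least `1/4`. -/
theorem stmt_3 (S : Finset (ℝ × ℝ)) (hcard : S.card = 4)
    (hS : ∀ p ∈ S, p.1 ∈ Set.Icc (0:ℝ) 1 ∧ p.2 ∈ Set.Icc (0:ℝ) 1) :
    ∃ a b c d : ℝ, 0 ≤ a ∧ a < b ∧ b ≤ 1 ∧ 0 ≤ c ∧ c < d ∧ d ≤ 1 ∧
      (∀ p ∈ S, ¬ (a < p.1 ∧ p.1 < b ∧ c < p.2 ∧ p.2 < d)) ∧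
      (1:ℝ) / 4 ≤ (b - a) * (d - c) := by
  by_contra hcon
  have hl : S.toList.length = 4 := by simpa using hcard
  have hm : ∀ p, p ∈ S ↔ p ∈ S.toList := fun p => by simp
  obtain ⟨p, q, r, s, hpq⟩ : ∃ p q r s, S.toList = [p, q, r, s] := by
    match hL : S.toList, hl with
    | [p, q, r, s], _ => exact ⟨p, q, r, s, rfl⟩
  have hm' : ∀ t, t ∈ S ↔ t = p ∨ t = q ∨ t = r ∨ t = s := fun t => by rw [hm, hpq]; simp
  have hb : Bad p.1 p.2 q.1 q.2 r.1 r.2 s.1 s.2 := by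
    intro a b c d ha hab hb hc hcd hd e1 e2 e3 e4
    by_contra! hh
    refine hcon ⟨a, b, c, d, ha, hab, hb, hc, hcd, hd, ?_, hh⟩
    intro t ht
    unfold Esc at *
    rcases (hm' t).1 ht with rfl | rfl | rfl | rfl <;> grind
  exact all4 hb (hS p ((hm' p).2 (by simp))) (hS q ((hm' q).2 (by simp)))
    (hS r ((hm' r).2 (by simp))) (hS s ((hm' s).2 (by simp)))
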